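/- The full subquantaloid TRSDist_cc(Q) of TRSDist(Q) determined by the Cauchy complete totally regular Q-semicategories is equivalent to TRSDist(Q): every totally regular Q-semicategory is isomorphic, as an object of TRSDist(Q), to a Cauchy complete one (namely its Cauchy completion). -/

import Mathlib

open CategoryTheory

universe u

variable (Q : Type u) [SmallCategory Q] [∀ X Y : Q, CompleteLattice (X ⟶ Y)]

/-- A (small) quantaloid: a category whose hom-sets are complete lattices and in which
composition distributes on both sides over arbitrary suprema. -/
class IsQuantaloid : Prop where
  comp_sSup : ∀ {X Y Z : Q} (f : X ⟶ Y) (S : Set (Y ⟶ Z)),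
      f ≫ sSup S = ⨆ g ∈ S, f ≫ g
  sSup_comp : ∀ {X Y Z : Q} (S : Set (X ⟶ Y)) (g : Y ⟶ Z),
      sSup S ≫ g = ⨆ f ∈ S, f ≫ g

/-- A `Q`-typed set together with a matrix of hom-arrows.  `A.hom a a' : A.ty a ⟶ A.ty a'`
is the hom-arrow written `A(a',a) : ta → ta'` in the paper. -/
structure QGraph where
  Obj : Type u
  ty : Obj → Q
  hom : ∀ a a' : Obj, ty a ⟶ ty a'

variable {Q}

namespace QGraph

/-- `Q`-semicategory: composition inequality. -/
def IsSemiCat (A : QGraph Q) : Prop :=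
  ∀ a a' a'' : A.Obj, A.hom a a' ≫ A.hom a' a'' ≤ A.hom a a''

/-- Regular `Q`-semicategory. -/
def IsRegular (A : QGraph Q) : Prop :=
  A.IsSemiCat ∧ ∀ a a'' : A.Obj, (⨆ a' : A.Obj, A.hom a a' ≫ A.hom a' a'') = A.hom a a''

/-- Totally regular `Q`-semicategory (elementary characterization):
`A(a,a)∘A(a,a') = A(a,a')` and `A(a',a)∘A(a,a) = A(a',a)`. -/
def IsTR (A : QGraph Q) : Prop :=
  A.IsSemiCat ∧ (∀ a a' : A.Obj, A.hom a a ≫ A.hom a a' = A.hom a a')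
    ∧ (∀ a a' : A.Obj, A.hom a' a ≫ A.hom a a = A.hom a' a)

/-- `Q`-category: composition inequality plus unit inequality. -/
def IsCat (A : QGraph Q) : Prop :=
  A.IsSemiCat ∧ ∀ a : A.Obj, 𝟙 (A.ty a) ≤ A.hom a a

/-- Normal `Q`-category: all endo-hom-arrows are identities. -/
def IsNormal (A : QGraph Q) : Prop :=
  ∀ a : A.Obj, A.hom a a = 𝟙 (A.ty a)

/-- The one-object structure `*_e` on an arrow `e : X ⟶ X`. -/
def single (X : Q) (e : X ⟶ X) : QGraph Q :=
  ⟨PUnit, fun _ => X, fun _ _ => e⟩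

/-- Full subgraph determined by a subset of the objects. -/
def restrict (A : QGraph Q) (s : Set A.Obj) : QGraph Q :=
  ⟨s, fun x => A.ty x, fun x y => A.hom x y⟩

end QGraph

/-- A matrix of `Q`-arrows: `Φ a b : ty a ⟶ ty b` is the paper's `Φ(b,a) : ta → tb`. -/
def QMat (A B : QGraph Q) : Type u :=
  ∀ (a : A.Obj) (b : B.Obj), A.ty a ⟶ B.ty b

/-- Composition of matrices: `(Ψ⊗Φ)(c,a) = ⋁_b Ψ(c,b)∘Φ(b,a)`. -/
def matComp {A B C : QGraph Q} (Φ : QMat A B) (Ψ : QMat B C) : QMat A C :=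
  fun a c => ⨆ b, Φ a b ≫ Ψ b c

/-- (Plain) distributor between `Q`-categories. -/
def IsDist {A B : QGraph Q} (Φ : QMat A B) : Prop :=
  (∀ (a : A.Obj) (b b' : B.Obj), Φ a b ≫ B.hom b b' ≤ Φ a b') ∧
  (∀ (a' a : A.Obj) (b : B.Obj), A.hom a' a ≫ Φ a b ≤ Φ a' b)

/-- Regular semidistributor. -/
def IsRSDist {A B : QGraph Q} (Φ : QMat A B) : Prop :=
  (∀ (a : A.Obj) (b' : B.Obj), (⨆ b, Φ a b ≫ B.hom b b') = Φ a b') ∧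
  (∀ (a' : A.Obj) (b : B.Obj), (⨆ a, A.hom a' a ≫ Φ a b) = Φ a' b)

/-- Adjunction `Φ ⊣ Ψ` (unit and counit inequalities) between matrices. -/
def MatAdj {A B : QGraph Q} (Φ : QMat A B) (Ψ : QMat B A) : Prop :=
  (∀ a a', A.hom a a' ≤ matComp Φ Ψ a a') ∧
  (∀ b b', matComp Ψ Φ b b' ≤ B.hom b b')

/-- A type-preserving object map. -/
structure ObjMap (A B : QGraph Q) where
  map : A.Obj → B.Obj
  ty_eq : ∀ a, B.ty (map a) = A.ty a

namespace ObjMap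

variable {A B C : QGraph Q}

/-- The matrix `B(-,F-)` induced by an object map. -/
def graph (F : ObjMap A B) : QMat A B :=
  fun a b => eqToHom (F.ty_eq a).symm ≫ B.hom (F.map a) b

/-- The matrix `B(F-,-)` induced by an object map. -/
def cograph (F : ObjMap A B) : QMat B A :=
  fun b a => B.hom b (F.map a) ≫ eqToHom (F.ty_eq a)

/-- Semifunctor: `A(a',a) ≤ B(Fa',Fa)`. -/
def IsSemiFun (F : ObjMap A B) : Prop :=
  ∀ a a', A.hom a a' ≤
    eqToHom (F.ty_eq a).symm ≫ B.hom (F.map a) (F.map a') ≫ eqToHom (F.ty_eq a')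

/-- Fully faithful semifunctor: `A(a',a) = B(Fa',Fa)`. -/
def IsFullyFaithful (F : ObjMap A B) : Prop :=
  ∀ a a', A.hom a a' =
    eqToHom (F.ty_eq a).symm ≫ B.hom (F.map a) (F.map a') ≫ eqToHom (F.ty_eq a')

/-- Regular semifunctor: a semifunctor such that `⋁_{a'} B(b,Fa')∘A(a',a) = B(b,Fa)` and
`⋁_{a'} A(a,a')∘B(Fa',b) = B(Fa,b)`. -/
def IsRSFun (F : ObjMap A B) : Prop :=
  F.IsSemiFun ∧
  (∀ a b, (⨆ a', A.hom a a' ≫ F.graph a' b) = F.graph a b) ∧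
  (∀ a b, (⨆ a', F.cograph b a' ≫ A.hom a' a) = F.cograph b a)

/-- Composition of object maps (`G ∘ F`). -/
def comp (F : ObjMap A B) (G : ObjMap B C) : ObjMap A C :=
  ⟨fun a => G.map (F.map a), fun a => (G.ty_eq (F.map a)).trans (F.ty_eq a)⟩

end ObjMap

/-- A left adjoint matrix `Φ` (with right adjoint `Ψ`) converges when it is induced by a
regular semifunctor, i.e. `Φ = B(-,F-)` and `Ψ = B(F-,-)`. -/
def Converges {A B : QGraph Q} (Φ : QMat A B) (Ψ : QMat B A) : Prop :=
  ∃ F : ObjMap A B, F.IsRSFun ∧ (∀ a b, Φ a b = F.graph a b) ∧ (∀ b a, Ψ b a = F.cograph b a)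

/-- Cauchy completeness of a totally regular `Q`-semicategory:
every Cauchy (left adjoint) regular semidistributor into it converges. -/
def CauchyComplete (B : QGraph Q) : Prop :=
  ∀ (A : QGraph Q), A.IsTR → ∀ (Φ : QMat A B) (Ψ : QMat B A),
    IsRSDist Φ → IsRSDist Ψ → MatAdj Φ Ψ → Converges Φ Ψ

/-- Cauchy completeness of a `Q`-category: every left adjoint distributor into it
is induced by a functor. -/
def CatCauchyComplete (B : QGraph Q) : Prop :=
  ∀ (A : QGraph Q), A.IsCat → ∀ (Φ : QMat A B) (Ψ : QMat B A),
    IsDist Φ → IsDist Ψ → MatAdj Φ Ψ →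
    ∃ F : ObjMap A B, F.IsSemiFun ∧ ∀ a b, Φ a b = F.graph a b

/-- An object `a` of a regular `Q`-semicategory is stable when it is the value of a regular
semifunctor on a one-object regular `Q`-semicategory `*_e` (`e` an idempotent). -/
def QGraph.Stable (A : QGraph Q) (a : A.Obj) : Prop :=
  ∃ (X : Q) (e : X ⟶ X), e ≫ e = e ∧
    ∃ F : ObjMap (QGraph.single X e) A, F.IsRSFun ∧ F.map PUnit.unit = a

/-- An object of the Cauchy completion of `B`: a left adjoint regular semidistributor
`φ : *_e ⇸ B` (for an idempotent `e : X ⟶ X` of `Q`) together with its right adjoint `ψ`. -/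
structure CCObj (B : QGraph Q) where
  X : Q
  e : X ⟶ X
  idem : e ≫ e = e
  φ : ∀ b : B.Obj, X ⟶ B.ty b
  ψ : ∀ b : B.Obj, B.ty b ⟶ X
  φ_regl : ∀ b', (⨆ b, φ b ≫ B.hom b b') = φ b'
  φ_regr : ∀ b, e ≫ φ b = φ b
  ψ_regl : ∀ b, ψ b ≫ e = ψ b
  ψ_regr : ∀ b', (⨆ b, B.hom b' b ≫ ψ b) = ψ b'
  unit : e ≤ ⨆ b, φ b ≫ ψ b
  counit : ∀ b b', ψ b ≫ φ b' ≤ B.hom b b'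

/-- The Cauchy completion `B_cc`; its hom-arrow from `p` to `q` is `B_cc(q,p) = q* ⊗ p`,
i.e. the lifting `[q,p]` in `TRSDist(Q)`. -/
def QGraph.cc (B : QGraph Q) : QGraph Q :=
  ⟨CCObj B, fun p => p.X, fun p q => ⨆ b, p.φ b ≫ q.ψ b⟩

/-- The object `k_B b`, i.e. the left adjoint `B(-,b) : *_{B(b,b)} ⇸ B` with right
adjoint `B(b,-)`. -/
def kObj {B : QGraph Q} (hB : B.IsTR) (b : B.Obj) : CCObj B where
  X := B.ty b
  e := B.hom b b
  idem := hB.2.1 b b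
  φ := fun y => B.hom b y
  ψ := fun y => B.hom y b
  φ_regl := fun b' =>
    le_antisymm (iSup_le fun y => hB.1 b y b') (le_iSup_of_le b (hB.2.1 b b').ge)
  φ_regr := fun y => hB.2.1 b y
  ψ_regl := fun y => hB.2.2 b y
  ψ_regr := fun b' =>
    le_antisymm (iSup_le fun y => hB.1 b' y b) (le_iSup_of_le b (hB.2.2 b b').ge)
  unit := le_iSup_of_le b (hB.2.1 b b).ge
  counit := fun y y' => hB.1 y b y'

/-- The Cauchy completion embedding `k_B : B → B_cc`. -/
def kMap {B : QGraph Q} (hB : B.IsTR) : ObjMap B (QGraph.cc B) :=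
  ⟨fun b => kObj hB b, fun _ => rfl⟩

namespace IsQuantaloid

variable [IsQuantaloid Q] {X Y Z : Q} {ι : Sort*}

theorem comp_iSup (f : X ⟶ Y) (g : ι → (Y ⟶ Z)) : f ≫ (⨆ i, g i) = ⨆ i, f ≫ g i := by
  rw [iSup, comp_sSup, iSup_range]

theorem iSup_comp (f : ι → (X ⟶ Y)) (g : Y ⟶ Z) : (⨆ i, f i) ≫ g = ⨆ i, f i ≫ g := by
  rw [iSup, sSup_comp, iSup_range]

theorem comp_mono {f f' : X ⟶ Y} {g g' : Y ⟶ Z} (hf : f ≤ f') (hg : g ≤ g') :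
    f ≫ g ≤ f' ≫ g' := by
  have h₁ : f ≫ g ≤ f ≫ g' := by
    have h := comp_sSup f {g, g'}
    rw [sSup_pair, iSup_pair, sup_eq_right.2 hg] at h
    exact h ▸ le_sup_left
  have h₂ : f ≫ g' ≤ f' ≫ g' := by
    have h := sSup_comp {f, f'} g'
    rw [sSup_pair, iSup_pair, sup_eq_right.2 hf] at h
    exact h ▸ le_sup_left
  exact h₁.trans h₂

end IsQuantaloid

open IsQuantaloid

namespace IsRSDist

variable {A B : QGraph Q} {Φ : QMat A B}

theorem matComp_hom (hΦ : IsRSDist Φ) :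
    matComp Φ (B.hom : QMat B B) = Φ :=
  funext fun a => funext fun b => hΦ.1 a b

theorem hom_matComp (hΦ : IsRSDist Φ) :
    matComp (A.hom : QMat A A) Φ = Φ :=
  funext fun a => funext fun b => hΦ.2 a b

/-- Over a totally regular domain, the endo-hom-arrows act as identities on `Φ`. -/
theorem hom_self_comp [IsQuantaloid Q] (hA : A.IsTR) (hΦ : IsRSDist Φ) (a : A.Obj)
    (b : B.Obj) : A.hom a a ≫ Φ a b = Φ a b := by
  rw [← hΦ.2 a b, comp_iSup]
  simp_rw [← Category.assoc, hA.2.1]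

/-- Over a totally regular codomain, the endo-hom-arrows act as identities on `Φ`. -/
theorem comp_hom_self [IsQuantaloid Q] (hB : B.IsTR) (hΦ : IsRSDist Φ) (a : A.Obj)
    (b : B.Obj) : Φ a b ≫ B.hom b b = Φ a b := by
  rw [← hΦ.1 a b, iSup_comp]
  simp_rw [Category.assoc, hB.2.2]

end IsRSDist

section Matrices

variable [IsQuantaloid Q] {A B C D : QGraph Q}

theorem matComp_assoc (Φ : QMat A B) (Ψ : QMat B C) (Θ : QMat C D) :
    matComp (matComp Φ Ψ) Θ = matComp Φ (matComp Ψ Θ) := by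
  funext a d
  simp_rw [matComp, iSup_comp, comp_iSup, Category.assoc]
  rw [iSup_comm]

theorem matComp_mono {Φ Φ' : QMat A B} {Ψ Ψ' : QMat B C} (hΦ : ∀ a b, Φ a b ≤ Φ' a b)
    (hΨ : ∀ b c, Ψ b c ≤ Ψ' b c) (a : A.Obj) (c : C.Obj) :
    matComp Φ Ψ a c ≤ matComp Φ' Ψ' a c :=
  iSup_mono fun b => comp_mono (hΦ a b) (hΨ b c)

theorem IsRSDist.matComp {Φ : QMat A B} {Ψ : QMat B C} (hΦ : IsRSDist Φ)
    (hΨ : IsRSDist Ψ) : IsRSDist (matComp Φ Ψ) :=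
  ⟨fun a c => congrFun (congrFun ((matComp_assoc Φ Ψ C.hom).trans
      (congrArg (_root_.matComp Φ) hΨ.matComp_hom)) a) c,
    fun a c => congrFun (congrFun ((matComp_assoc A.hom Φ Ψ).symm.trans
      (congrArg (_root_.matComp · Ψ) hΦ.hom_matComp)) a) c⟩

theorem MatAdj.comp {Φ : QMat A B} {Ψ : QMat B A} {Φ' : QMat B C} {Ψ' : QMat C B}
    (hΦ : IsRSDist Φ) (hΦ' : IsRSDist Φ') (h : MatAdj Φ Ψ) (h' : MatAdj Φ' Ψ') :
    MatAdj (matComp Φ Φ') (matComp Ψ' Ψ) := by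
  refine ⟨fun a a' => (h.1 a a').trans ?_, fun c c' => le_trans ?_ (h'.2 c c')⟩
  · rw [matComp_assoc, ← matComp_assoc Φ', ← matComp_assoc]
    refine matComp_mono (fun a b => ?_) (fun _ _ => le_rfl) a a'
    exact (hΦ.1 a b).ge.trans (matComp_mono (fun _ _ => le_rfl) h'.1 a b)
  · rw [matComp_assoc, ← matComp_assoc Ψ]
    refine matComp_mono (fun _ _ => le_rfl) (fun b c => ?_) c c'
    exact (matComp_mono h.2 (fun _ _ => le_rfl) b c).trans_eq (hΦ'.2 b c)

end Matrices

namespace QGraph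

/-- The tautological matrix `B_cc ⇸ B`, whose row at `p` is the left adjoint `p.φ`. -/
def ccLeft (B : QGraph Q) : QMat B.cc B := fun p b => CCObj.φ p b

/-- The tautological matrix `B ⇸ B_cc`, whose column at `p` is the right adjoint `p.ψ`. -/
def ccRight (B : QGraph Q) : QMat B B.cc := fun b p => CCObj.ψ p b

variable (B : QGraph Q)

theorem ccLeft_matComp_ccRight : matComp B.ccLeft B.ccRight = B.cc.hom := rfl

theorem ccLeft_matComp_hom : matComp B.ccLeft (B.hom : QMat B B) = B.ccLeft :=
  funext fun p => funext fun b => CCObj.φ_regl p b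

theorem hom_matComp_ccRight : matComp (B.hom : QMat B B) B.ccRight = B.ccRight :=
  funext fun b => funext fun p => CCObj.ψ_regr p b

theorem ccRight_matComp_ccLeft_le (b b' : B.Obj) :
    matComp B.ccRight B.ccLeft b b' ≤ B.hom b b' :=
  iSup_le fun p => CCObj.counit p b b'

theorem matAdj_ccLeft_ccRight : MatAdj B.ccLeft B.ccRight :=
  ⟨fun _ _ => le_rfl, B.ccRight_matComp_ccLeft_le⟩

variable {B} in
theorem ccRight_matComp_ccLeft (hB : B.IsTR) (b b' : B.Obj) :
    matComp B.ccRight B.ccLeft b b' = B.hom b b' :=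
  (B.ccRight_matComp_ccLeft_le b b').antisymm
    (le_iSup_of_le (f := fun p => B.ccRight b p ≫ B.ccLeft p b') (kObj hB b)
      (hB.2.1 b b').ge)

variable [IsQuantaloid Q]

theorem cc_hom_matComp_ccLeft_le (p : B.cc.Obj) (b : B.Obj) :
    matComp (B.cc.hom : QMat B.cc B.cc) B.ccLeft p b ≤ B.ccLeft p b := by
  rw [← ccLeft_matComp_ccRight, matComp_assoc]
  exact (matComp_mono (fun _ _ => le_rfl) B.ccRight_matComp_ccLeft_le p b).trans_eq
    (congrFun (congrFun B.ccLeft_matComp_hom p) b)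

theorem ccRight_matComp_cc_hom_le (b : B.Obj) (p : B.cc.Obj) :
    matComp B.ccRight (B.cc.hom : QMat B.cc B.cc) b p ≤ B.ccRight b p := by
  rw [← ccLeft_matComp_ccRight, ← matComp_assoc]
  exact (matComp_mono B.ccRight_matComp_ccLeft_le (fun _ _ => le_rfl) b p).trans_eq
    (congrFun (congrFun B.hom_matComp_ccRight b) p)

theorem cc_hom_self_comp_ccLeft (p : B.cc.Obj) (b : B.Obj) :
    B.cc.hom p p ≫ B.ccLeft p b = B.ccLeft p b :=
  ((le_iSup (fun q => B.cc.hom p q ≫ B.ccLeft q b) p).trans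
    (B.cc_hom_matComp_ccLeft_le p b)).antisymm
      ((CCObj.φ_regr p b).ge.trans (comp_mono (CCObj.unit p) le_rfl))

theorem ccRight_comp_cc_hom_self (b : B.Obj) (p : B.cc.Obj) :
    B.ccRight b p ≫ B.cc.hom p p = B.ccRight b p :=
  ((le_iSup (fun q => B.ccRight b q ≫ B.cc.hom q p) p).trans
    (B.ccRight_matComp_cc_hom_le b p)).antisymm
      ((CCObj.ψ_regl p b).ge.trans (comp_mono le_rfl (CCObj.unit p)))

theorem isRSDist_ccLeft : IsRSDist B.ccLeft :=
  ⟨fun p b => CCObj.φ_regl p b, fun p b => (B.cc_hom_matComp_ccLeft_le p b).antisymm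
    (le_iSup_of_le (f := fun q => B.cc.hom p q ≫ B.ccLeft q b) p
      (B.cc_hom_self_comp_ccLeft p b).ge)⟩

theorem isRSDist_ccRight : IsRSDist B.ccRight :=
  ⟨fun b p => (B.ccRight_matComp_cc_hom_le b p).antisymm
    (le_iSup_of_le (f := fun q => B.ccRight b q ≫ B.cc.hom q p) p
      (B.ccRight_comp_cc_hom_self b p).ge), fun b p => CCObj.ψ_regr p b⟩

/-- The Cauchy completion is totally regular. -/
theorem cc_isTR : B.cc.IsTR := by
  refine ⟨fun p q r => ?_, fun p q => ?_, fun q p => ?_⟩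
  · refine (le_iSup (fun q => B.cc.hom p q ≫ B.cc.hom q r) q).trans_eq ?_
    exact (B.isRSDist_ccLeft.matComp B.isRSDist_ccRight).1 p r
  · exact (comp_iSup _ _).trans (iSup_congr fun b => (Category.assoc _ _ _).symm.trans
      (congrArg (· ≫ B.ccRight b q) (B.cc_hom_self_comp_ccLeft p b)))
  · exact (iSup_comp _ _).trans (iSup_congr fun b => (Category.assoc _ _ _).trans
      (congrArg (B.ccLeft p b ≫ ·) (B.ccRight_comp_cc_hom_self b q)))

end QGraph

section Representing

variable [IsQuantaloid Q] {A B : QGraph Q}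

/-- The object of `B_cc` given by the component at `a` of an adjunction `Φ ⊣ Ψ` into `B`. -/
def MatAdj.ccObj (hA : A.IsTR) {Φ : QMat A B} {Ψ : QMat B A} (hΦ : IsRSDist Φ)
    (hΨ : IsRSDist Ψ) (h : MatAdj Φ Ψ) (a : A.Obj) : CCObj B where
  X := A.ty a
  e := A.hom a a
  idem := hA.2.1 a a
  φ := Φ a
  ψ := fun b => Ψ b a
  φ_regl := hΦ.1 a
  φ_regr := hΦ.hom_self_comp hA a
  ψ_regl := fun b => hΨ.comp_hom_self hA b a
  ψ_regr := fun b => hΨ.2 b a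
  unit := h.1 a a
  counit := fun b b' => (le_iSup (fun a => Ψ b a ≫ Φ a b') a).trans (h.2 b b')

/-- The Cauchy completion is Cauchy complete. -/
theorem QGraph.cc_cauchyComplete (B : QGraph Q) : CauchyComplete B.cc := by
  intro A hA Φ Ψ hΦ hΨ h
  let F : ObjMap A B.cc :=
    ⟨MatAdj.ccObj hA (hΦ.matComp B.isRSDist_ccLeft) (B.isRSDist_ccRight.matComp hΨ)
      (h.comp hΦ B.isRSDist_ccLeft B.matAdj_ccLeft_ccRight), fun _ => rfl⟩
  have hF : ∀ a q, B.cc.hom (F.map a) q = Φ a q := fun a q =>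
    (congrFun (congrFun (matComp_assoc Φ B.ccLeft B.ccRight) a) q).trans (hΦ.1 a q)
  have hF' : ∀ q a, B.cc.hom q (F.map a) = Ψ q a := fun q a =>
    (congrFun (congrFun (matComp_assoc B.ccLeft B.ccRight Ψ) q) a).symm.trans (hΨ.2 q a)
  have hg : F.graph = Φ := by
    funext a q
    exact (Category.id_comp _).trans (hF a q)
  have hc : F.cograph = Ψ := by
    funext q a
    exact (Category.comp_id _).trans (hF' q a)
  refine ⟨F, ⟨fun a a' => ?_, ?_, ?_⟩, fun a q => by rw [hg], fun q a => by rw [hc]⟩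
  · have hs : A.hom a a' ≤ B.cc.hom (F.map a) (F.map a') :=
      (h.comp hΦ B.isRSDist_ccLeft B.matAdj_ccLeft_ccRight).1 a a'
    exact hs.trans_eq ((Category.id_comp _).trans (Category.comp_id _)).symm
  · rw [hg]
    exact hΦ.2
  · rw [hc]
    exact fun a q => hΨ.1 q a

end Representing

/-- `TRSDist_cc(Q)` is equivalent to `TRSDist(Q)`: every totally regular
`Q`-semicategory is isomorphic in `TRSDist(Q)` to a Cauchy complete one. -/
theorem every_TRS_iso_to_cauchyComplete [IsQuantaloid Q] :
    ∀ A : QGraph Q, A.IsTR →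
      ∃ B : QGraph Q, B.IsTR ∧ CauchyComplete B ∧
        ∃ (Φ : QMat A B) (Ψ : QMat B A), IsRSDist Φ ∧ IsRSDist Ψ ∧
          (∀ a a', matComp Φ Ψ a a' = A.hom a a') ∧
          (∀ b b', matComp Ψ Φ b b' = B.hom b b') := by
  exact fun A hA => ⟨A.cc, A.cc_isTR, A.cc_cauchyComplete, A.ccRight, A.ccLeft,
    A.isRSDist_ccRight, A.isRSDist_ccLeft, A.ccRight_matComp_ccLeft hA, fun _ _ => rfl⟩
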